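/- arXiv:2302.02132 — 6 statements merged into one kernel-verified Lean document; each statement's English description precedes it below -/
import Mathlib

section
/- Let P ⊂ ℝ be a finite nonempty labelled point set and let b ∈ ℝ be a decision boundary point of P, i.e., f_P(b) contains at least two distinct labels. Then b ∉ P, the sets {p ∈ P : p < b} and {p ∈ P : p > b} are both nonempty, and, writing p₁ = max{p ∈ P : p < b} and p₂ = min{p ∈ P : p > b}, we have b = (p₁ + p₂)/2, the set of nearest neighbors of b in P is exactly {p₁, p₂}, and c(p₁) ≠ c(p₂). -/
open Set

/-- The nearest-neighbor classification induced by a labelled point set `(P, c)` in `ℝ`: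
`nnClass P c q` is the set of labels of nearest neighbors of `q` in `P`. -/
def nnClass {L : Type*} (P : Set ℝ) (c : ℝ → L) (q : ℝ) : Set L :=
  {l | ∃ p ∈ P, (∀ p' ∈ P, dist q p ≤ dist q p') ∧ c p = l}

/-- `Q` is a reduced training set of `(P, c)`. -/
def IsRTS {L : Type*} (P : Set ℝ) (c : ℝ → L) (Q : Set ℝ) : Prop :=
  Q ⊆ P ∧ nnClass Q c = nnClass P c

/-- `b` is a decision boundary point of `(P, c)`: its set of nearest-neighbor
labels has at least two elements. -/
def IsBoundary {L : Type*} (P : Set ℝ) (c : ℝ → L) (b : ℝ) : Prop :=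
  (nnClass P c b).Nontrivial

/-- Two distinct real numbers equidistant from `b` have `b` as their midpoint. -/
theorem eq_midpoint_of_dist_eq {b x y : ℝ} (hxy : x ≠ y) (h : dist b x = dist b y) :
    b = (x + y) / 2 := by
  rw [Real.dist_eq, Real.dist_eq, abs_eq_abs] at h
  rcases h with h | h
  · exact absurd (by linarith) hxy
  · linarith

/-- If `x` is at distance `b - x ≥ 0` from `b` and no point of `P` is closer to `b`, then every
point of `P` lies outside the open interval between `x` and its reflection in `b`. -/
theorem le_or_reflection_le_of_forall_dist_le {P : Set ℝ} {b x : ℝ} (hxb : x ≤ b)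
    (h : ∀ p ∈ P, dist b x ≤ dist b p) {p : ℝ} (hp : p ∈ P) : p ≤ x ∨ 2 * b - x ≤ p := by
  have hd := h p hp
  rw [Real.dist_eq, Real.dist_eq, abs_of_nonneg (sub_nonneg.2 hxb), le_abs] at hd
  rcases hd with hd | hd
  · left; linarith
  · right; linarith

/-- Structure of a decision boundary point: it is not in `P`, has points of `P` on
both sides, is the midpoint of its closest smaller and larger neighbors `p₁, p₂` in
`P`, its nearest neighbors in `P` are exactly `{p₁, p₂}`, and `c p₁ ≠ c p₂`. -/
theorem boundary_structure {L : Type*} (P : Set ℝ) (c : ℝ → L)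
    (hfin : P.Finite) (hne : P.Nonempty) (b : ℝ) (hb : IsBoundary P c b) :
    b ∉ P ∧ {p ∈ P | p < b}.Nonempty ∧ {p ∈ P | b < p}.Nonempty ∧
      ∃ p₁ p₂ : ℝ, IsGreatest {p ∈ P | p < b} p₁ ∧ IsLeast {p ∈ P | b < p} p₂ ∧
        b = (p₁ + p₂) / 2 ∧
        {p ∈ P | ∀ p' ∈ P, dist b p ≤ dist b p'} = {p₁, p₂} ∧
        c p₁ ≠ c p₂ := by
  obtain ⟨_, ⟨x, hx, hxmin, rfl⟩, _, ⟨y, hy, hymin, rfl⟩, hc⟩ := hb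
  have hxy : x ≠ y := fun h => hc (congrArg c h)
  wlog hlt : x < y generalizing x y
  · exact this y hy hymin x hx hxmin hc.symm hxy.symm (lt_of_le_of_ne (not_lt.1 hlt) hxy.symm)
  have hdist : dist b x = dist b y := le_antisymm (hxmin y hy) (hymin x hx)
  have hb : b = (x + y) / 2 := eq_midpoint_of_dist_eq hxy hdist
  have hxb : x < b := by linarith
  have hby : b < y := by linarith
  have hout : ∀ p ∈ P, p ≤ x ∨ y ≤ p := fun p hp => by
    rcases le_or_reflection_le_of_forall_dist_le hxb.le hxmin hp with h | h
    · exact Or.inl h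
    · right; linarith
  refine ⟨fun hbP => ?_, ⟨x, hx, hxb⟩, ⟨y, hy, hby⟩, x, y, ⟨⟨hx, hxb⟩, ?_⟩, ⟨⟨hy, hby⟩, ?_⟩, hb,
    ?_, hc⟩
  · rcases hout b hbP with h | h <;> linarith
  · rintro p ⟨hp, hpb⟩
    exact (hout p hp).resolve_right (by linarith)
  · rintro p ⟨hp, hpb⟩
    exact (hout p hp).resolve_left (by linarith)
  · ext p
    constructor
    · rintro ⟨hp, hpmin⟩
      by_cases hpx : p = x
      · exact Or.inl hpx
      · right
        have hmid := eq_midpoint_of_dist_eq hpx (le_antisymm (hpmin x hx) (hxmin p hp))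
        rw [mem_singleton_iff]
        linarith
    · rintro (rfl | rfl)
      · exact ⟨hx, hxmin⟩
      · exact ⟨hy, hymin⟩
end

section
/- Let P ⊂ ℝ be a finite nonempty labelled point set, let Q ⊆ P be a reduced training set of (P,c), and let b be a decision boundary point of P. Then the sets {q ∈ Q : q < b} and {q ∈ Q : q > b} are both nonempty, and b is the midpoint of its closest smaller and closest larger neighbors in Q: b = (max{q ∈ Q : q < b} + min{q ∈ Q : q > b})/2. -/
open Set

/-- Two distinct nearest neighbors of `b` in `Q` are the closest points of `Q` on either side
of `b`. -/
theorem closest_neighbors_of_lt {Q : Set ℝ} {b p₁ p₂ : ℝ} (h₁ : p₁ ∈ Q) (h₂ : p₂ ∈ Q)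
    (hn₁ : ∀ p ∈ Q, dist b p₁ ≤ dist b p) (hn₂ : ∀ p ∈ Q, dist b p₂ ≤ dist b p)
    (hlt : p₁ < p₂) :
    IsGreatest {q ∈ Q | q < b} p₁ ∧ IsLeast {q ∈ Q | b < q} p₂ ∧ b = (p₁ + p₂) / 2 := by
  have hmid : b = (p₁ + p₂) / 2 := by
    have heq : |b - p₁| = |b - p₂| := le_antisymm (hn₁ p₂ h₂) (hn₂ p₁ h₁)
    rcases abs_eq_abs.mp heq with h | h <;> linarith
  refine ⟨⟨⟨h₁, by linarith⟩, ?_⟩, ⟨⟨h₂, by linarith⟩, ?_⟩, hmid⟩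
  · rintro q ⟨hq, hqb⟩
    have h := hn₁ q hq
    rw [Real.dist_eq, Real.dist_eq, abs_of_pos (by linarith), abs_of_pos (by linarith)] at h
    linarith
  · rintro q ⟨hq, hqb⟩
    have h := hn₂ q hq
    rw [Real.dist_eq, Real.dist_eq, abs_of_neg (by linarith), abs_of_neg (by linarith)] at h
    linarith

/-- Every decision boundary point of `P` has points of any reduced training set `Q`
on both sides, and is the midpoint of its closest smaller and larger neighbors in `Q`. -/
theorem boundary_midpoint_of_RTS {L : Type*} (P : Set ℝ) (c : ℝ → L)
    (hfin : P.Finite) (hne : P.Nonempty)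
    (Q : Set ℝ) (hQ : IsRTS P c Q) (b : ℝ) (hb : IsBoundary P c b) :
    {q ∈ Q | q < b}.Nonempty ∧ {q ∈ Q | b < q}.Nonempty ∧
      ∃ q₁ q₂ : ℝ, IsGreatest {q ∈ Q | q < b} q₁ ∧ IsLeast {q ∈ Q | b < q} q₂ ∧
        b = (q₁ + q₂) / 2 := by
  suffices h : ∃ q₁ q₂ : ℝ, IsGreatest {q ∈ Q | q < b} q₁ ∧ IsLeast {q ∈ Q | b < q} q₂ ∧
      b = (q₁ + q₂) / 2 by
    obtain ⟨q₁, q₂, h₁, h₂, -⟩ := id h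
    exact ⟨h₁.nonempty, h₂.nonempty, h⟩
  rw [IsBoundary, ← hQ.2] at hb
  obtain ⟨_, ⟨p₁, h₁, hn₁, rfl⟩, _, ⟨p₂, h₂, hn₂, rfl⟩, hc⟩ := hb
  rcases lt_or_gt_of_ne (ne_of_apply_ne c hc) with hlt | hlt
  · exact ⟨p₁, p₂, closest_neighbors_of_lt h₁ h₂ hn₁ hn₂ hlt⟩
  · exact ⟨p₂, p₁, closest_neighbors_of_lt h₂ h₁ hn₂ hn₁ hlt⟩
end

section
/- Let P ⊂ ℝ be a finite nonempty labelled point set and let b < b' be two decision boundary points of P such that no decision boundary point of P lies in the open interval (b, b'). Then every reduced training set Q of (P,c) contains at least one point in (b, b'), i.e., Q ∩ (b, b') ≠ ∅. -/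
open Set

/-- A decision boundary point is the midpoint of two of its nearest neighbors. -/
theorem IsBoundary.exists_nearest_pair {L : Type*} {P : Set ℝ} {c : ℝ → L} {b : ℝ}
    (hb : IsBoundary P c b) :
    ∃ d : ℝ, 0 < d ∧ b - d ∈ P ∧ b + d ∈ P ∧ ∀ p ∈ P, p ≤ b - d ∨ b + d ≤ p := by
  obtain ⟨_, ⟨p, hp, hpmin, rfl⟩, _, ⟨q, hq, hqmin, rfl⟩, hpq⟩ := hb
  have hne : p ≠ q := fun h => hpq (congrArg c h)
  simp only [Real.dist_eq] at hpmin hqmin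
  have hsep : ∀ r ∈ P, r ≤ b - |b - p| ∨ b + |b - p| ≤ r := fun r hr => by
    rcases le_abs.mp (hpmin r hr) with h | h
    · exact Or.inl (by linarith)
    · exact Or.inr (by linarith)
  rcases abs_eq_abs.mp (le_antisymm (hpmin q hq) (hqmin p hp)) with h | h
  · exact absurd (by linarith) hne
  · refine ⟨|b - p|, abs_pos.mpr fun h0 => hne (by linarith), ?_, ?_, hsep⟩
    · rcases abs_choice (b - p) with h' | h' <;> rw [h']
      · rwa [sub_sub_cancel]
      · rwa [h, neg_neg, sub_sub_cancel]
    · rcases abs_choice (b - p) with h' | h' <;> rw [h']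
      · rwa [h, ← sub_eq_add_neg, sub_sub_cancel]
      · rwa [← sub_eq_add_neg, sub_sub_cancel]

/-- Between any two consecutive decision boundary points, every reduced training set
contains at least one point. -/
theorem RTS_nonempty_between_boundaries {L : Type*} (P : Set ℝ) (c : ℝ → L)
    (hfin : P.Finite) (hne : P.Nonempty)
    (b b' : ℝ) (hbb' : b < b') (hb : IsBoundary P c b) (hb' : IsBoundary P c b')
    (hcons : ∀ x ∈ Set.Ioo b b', ¬ IsBoundary P c x)
    (Q : Set ℝ) (hQ : IsRTS P c Q) :
    (Q ∩ Set.Ioo b b').Nonempty := by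
  have hbQ : IsBoundary Q c b := by rwa [IsBoundary, hQ.2]
  have hbQ' : IsBoundary Q c b' := by rwa [IsBoundary, hQ.2]
  obtain ⟨d, hd, hl, hr, hsep⟩ := hbQ.exists_nearest_pair
  obtain ⟨e, he, hl', hr', hsep'⟩ := hbQ'.exists_nearest_pair
  by_contra hempty
  have hout : ∀ p ∈ Q, p ≤ b ∨ b' ≤ p := fun p hp => by
    by_contra! h
    exact hempty ⟨p, hp, h⟩
  -- Both boundary points have the same pair of nearest neighbors, hence the same midpoint.
  have hleft : b - d = b' - e := by
    rcases hsep' _ hl with h | h <;> rcases hsep _ hl' with h' | h' <;>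
      rcases hout _ hl' with h'' | h'' <;> linarith
  have hright : b + d = b' + e := by
    rcases hsep' _ hr with h | h <;> rcases hsep _ hr' with h' | h' <;>
      rcases hout _ hr with h'' | h'' <;> linarith
  linarith
end

section
/- Let P ⊂ ℝ be a finite nonempty labelled point set and let Q be a reduced training set of (P,c) of minimum cardinality (i.e., |Q| ≤ |Q'| for every reduced training set Q' of (P,c)). Then for any two decision boundary points b < b' of P with no decision boundary point in the open interval (b, b'), Q contains at most two points of (b, b'): |Q ∩ (b, b')| ≤ 2. -/
open Set

/-- Two points of a finite set lying in an interval free of boundary points have the same label. -/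
theorem label_eq_of_no_boundary {L : Type*} {Q : Set ℝ} {c : ℝ → L} (hfin : Q.Finite) {b b' : ℝ}
    (hcons : ∀ x ∈ Set.Ioo b b', ¬ IsBoundary Q c x) {x y : ℝ}
    (hx : x ∈ Q ∩ Set.Ioo b b') (hy : y ∈ Q ∩ Set.Ioo b b') : c x = c y := by
  by_contra hxy
  -- A closest pair of differently labelled points has no further point in between.
  let S : Set (ℝ × ℝ) :=
    {p ∈ (Q ∩ Set.Ioo b b') ×ˢ (Q ∩ Set.Ioo b b') | c p.1 ≠ c p.2 ∧ p.1 < p.2}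
  have hI := hfin.inter_of_left (Set.Ioo b b')
  have hS : S.Finite := (hI.prod hI).subset (Set.sep_subset _ _)
  have hne : S.Nonempty := by
    rcases lt_trichotomy x y with h | h | h
    · exact ⟨(x, y), ⟨hx, hy⟩, hxy, h⟩
    · exact absurd (congrArg c h) hxy
    · exact ⟨(y, x), ⟨hy, hx⟩, Ne.symm hxy, h⟩
  obtain ⟨⟨s, t⟩, ⟨⟨⟨hsQ, hsb, hsb'⟩, ⟨htQ, htb, htb'⟩⟩, hc, hst⟩, hmin⟩ :=
    Set.exists_min_image S (fun p => p.2 - p.1) hS hne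
  dsimp only at hsQ hsb hsb' htQ htb htb' hc hst hmin
  have hgap : ∀ z ∈ Q, z ≤ s ∨ t ≤ z := by
    intro z hz
    by_contra! h
    have hzI : z ∈ Q ∩ Set.Ioo b b' := ⟨hz, by linarith, by linarith⟩
    by_cases hcz : c s = c z
    · have := hmin (z, t) ⟨⟨hzI, htQ, htb, htb'⟩, fun h' => hc (hcz.trans h'), h.2⟩
      dsimp only at this
      linarith
    · have := hmin (s, z) ⟨⟨⟨hsQ, hsb, hsb'⟩, hzI⟩, hcz, h.1⟩
      dsimp only at this
      linarith
  have hs : dist ((s + t) / 2) s = (t - s) / 2 := by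
    rw [Real.dist_eq, abs_of_nonneg] <;> linarith
  have ht : dist ((s + t) / 2) t = (t - s) / 2 := by
    rw [Real.dist_eq, abs_of_nonpos] <;> linarith
  have hfar : ∀ z ∈ Q, (t - s) / 2 ≤ dist ((s + t) / 2) z := by
    intro z hz
    rw [Real.dist_eq, le_abs]
    rcases hgap z hz with h | h
    · left; linarith
    · right; linarith
  exact hcons ((s + t) / 2) ⟨by linarith, by linarith⟩
    ⟨c s, ⟨s, hsQ, fun z hz => hs ▸ hfar z hz, rfl⟩,
      c t, ⟨t, htQ, fun z hz => ht ▸ hfar z hz, rfl⟩, hc⟩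

/-- Removing a point that lies between two other points does not change the classification, if all
points between those two have the same label. -/
theorem nnClass_diff_singleton {L : Type*} {Q : Set ℝ} {c : ℝ → L} (hfin : Q.Finite) {x y z : ℝ}
    (hx : x ∈ Q) (hy : y ∈ Q) (hz : z ∈ Q) (hxy : x < y) (hyz : y < z)
    (hc : ∀ p ∈ Q, x ≤ p → p ≤ z → c p = c y) : nnClass (Q \ {y}) c = nnClass Q c := by
  have hxQ : x ∈ Q \ {y} := ⟨hx, hxy.ne⟩
  have hzQ : z ∈ Q \ {y} := ⟨hz, hyz.ne'⟩
  funext q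
  by_cases hq : ∀ p ∈ Q, dist q y ≤ dist q p
  · have hqx : x < q := by
      by_contra! h
      have := hq x hx
      rw [Real.dist_eq, Real.dist_eq, abs_of_nonpos (by linarith),
        abs_of_nonpos (by linarith)] at this
      linarith
    have hqz : q < z := by
      by_contra! h
      have := hq z hz
      rw [Real.dist_eq, Real.dist_eq, abs_of_nonneg (by linarith),
        abs_of_nonneg (by linarith)] at this
      linarith
    have hlabel : ∀ p ∈ Q, dist q p ≤ dist q x → dist q p ≤ dist q z → c p = c y := by
      intro p hp hpx hpz
      rw [Real.dist_eq, Real.dist_eq, abs_le] at hpx hpz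
      rw [abs_of_pos (by linarith)] at hpx
      rw [abs_of_neg (by linarith)] at hpz
      exact hc p hp (by linarith) (by linarith)
    obtain ⟨p, hp, hpmin⟩ :=
      Set.exists_min_image (Q \ {y}) (dist q) hfin.sdiff ⟨x, hxQ⟩
    ext l
    constructor
    · rintro ⟨r, hr, hrmin, rfl⟩
      exact ⟨y, hy, hq, (hlabel r hr.1 (hrmin x hxQ) (hrmin z hzQ)).symm⟩
    · rintro ⟨r, hr, hrmin, rfl⟩
      exact ⟨p, hp, hpmin, (hlabel p hp.1 (hpmin x hxQ) (hpmin z hzQ)).trans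
        (hlabel r hr (hrmin x hx) (hrmin z hz)).symm⟩
  · push Not at hq
    obtain ⟨w, hw, hwy⟩ := hq
    have hwQ : w ∈ Q \ {y} := ⟨hw, fun h => hwy.ne (congrArg (dist q) h)⟩
    ext l
    constructor
    · rintro ⟨r, hr, hrmin, rfl⟩
      refine ⟨r, hr.1, fun p hp => ?_, rfl⟩
      by_cases hpy : p = y
      · exact hpy ▸ (hrmin w hwQ).trans hwy.le
      · exact hrmin p ⟨hp, hpy⟩
    · rintro ⟨r, hr, hrmin, rfl⟩
      refine ⟨r, ⟨hr, fun h => ?_⟩, fun p hp => hrmin p hp.1, rfl⟩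
      exact (hrmin w hw).not_gt (h ▸ hwy)

/-- A set of more than two elements of a linear order contains a strictly increasing triple. -/
theorem exists_lt_lt_of_two_lt_ncard {α : Type*} [LinearOrder α] {S : Set α} (h : 2 < S.ncard) :
    ∃ x ∈ S, ∃ y ∈ S, ∃ z ∈ S, x < y ∧ y < z := by
  obtain ⟨x, y, z, hx, hy, hz, hxy, hxz, hyz⟩ :=
    (Set.two_lt_ncard_iff (Set.finite_of_ncard_pos (by omega))).1 h
  rcases hxy.lt_or_gt with h₁ | h₁ <;> rcases hxz.lt_or_gt with h₂ | h₂ <;>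
    rcases hyz.lt_or_gt with h₃ | h₃ <;> grind

/-- A minimum-cardinality reduced training set contains at most two points strictly
between any two consecutive decision boundary points. -/
theorem min_RTS_at_most_two_between_boundaries {L : Type*} (P : Set ℝ) (c : ℝ → L)
    (hfin : P.Finite) (hne : P.Nonempty)
    (Q : Set ℝ) (hQ : IsRTS P c Q)
    (hmin : ∀ Q' : Set ℝ, IsRTS P c Q' → Q.ncard ≤ Q'.ncard)
    (b b' : ℝ) (hbb' : b < b') (hb : IsBoundary P c b) (hb' : IsBoundary P c b')
    (hcons : ∀ x ∈ Set.Ioo b b', ¬ IsBoundary P c x) :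
    (Q ∩ Set.Ioo b b').ncard ≤ 2 := by
  obtain ⟨hQP, hQc⟩ := hQ
  have hQfin : Q.Finite := hfin.subset hQP
  have hconsQ : ∀ x ∈ Set.Ioo b b', ¬ IsBoundary Q c x := by
    simpa only [IsBoundary, hQc] using hcons
  by_contra! h
  obtain ⟨x, hx, y, hy, z, hz, hxy, hyz⟩ := exists_lt_lt_of_two_lt_ncard h
  have hdiff : nnClass (Q \ {y}) c = nnClass Q c :=
    nnClass_diff_singleton hQfin hx.1 hy.1 hz.1 hxy hyz fun p hp hxp hpz =>
      label_eq_of_no_boundary hQfin hconsQ ⟨hp, hx.2.1.trans_le hxp, hpz.trans_lt hz.2.2⟩ hy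
  exact (hmin (Q \ {y}) ⟨Set.sdiff_subset.trans hQP, hdiff.trans hQc⟩).not_gt
    (Set.ncard_sdiff_singleton_lt_of_mem hy.1 hQfin)
end

section
/- Let P ⊂ ℝ be a finite nonempty labelled point set whose set B of decision boundary points is nonempty. For each b ∈ B define l(b) = max{p ∈ P : p < b} and r(b) = min{p ∈ P : p > b} (these exist). Then Q = { l(b) : b ∈ B } ∪ { r(b) : b ∈ B } is a reduced training set of (P,c); in particular, (P,c) admits a reduced training set of size at most 2|B|. -/
open Set

/-- Two points of `P` with different labels are separated by a decision boundary point, namely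
the midpoint of two consecutive points of `P` between them. -/
theorem exists_isBoundary_between {L : Type*} {P : Set ℝ} {c : ℝ → L} (hfin : P.Finite)
    {x y : ℝ} (hx : x ∈ P) (hy : y ∈ P) (hxy : x < y) (hc : c x ≠ c y) :
    ∃ b, IsBoundary P c b ∧ ∃ p ∈ P, ∃ p' ∈ P, x ≤ p ∧ p < b ∧ b < p' ∧ p' ≤ y := by
  obtain ⟨p, ⟨hpP, hpy, hpc⟩, hpmax⟩ := Set.exists_max_image {z ∈ P | z ≤ y ∧ c z = c x} id
    (hfin.subset (sep_subset _ _)) ⟨x, hx, hxy.le, rfl⟩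
  have hpy' : p < y := lt_of_le_of_ne hpy (by rintro rfl; exact hc hpc.symm)
  obtain ⟨p', ⟨hpP', hpp'⟩, hpmin⟩ := Set.exists_min_image {z ∈ P | p < z} id
    (hfin.subset (sep_subset _ _)) ⟨y, hy, hpy'⟩
  have hp'y : p' ≤ y := hpmin y ⟨hy, hpy'⟩
  have hcp' : c p ≠ c p' := fun h =>
    absurd (hpmax p' ⟨hpP', hp'y, h ▸ hpc⟩) (not_le.mpr hpp')
  have hdist : ∀ z ∈ P, (p' - p) / 2 ≤ dist ((p + p') / 2) z := by
    intro z hz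
    rw [Real.dist_eq, le_abs]
    rcases le_or_gt z p with h | h
    · left; linarith
    · right
      have : p' ≤ z := hpmin z ⟨hz, h⟩
      linarith
  have hdp : dist ((p + p') / 2) p = (p' - p) / 2 := by
    rw [Real.dist_eq, abs_of_pos] <;> linarith
  have hdp' : dist ((p + p') / 2) p' = (p' - p) / 2 := by
    rw [Real.dist_eq, abs_of_neg] <;> linarith
  refine ⟨(p + p') / 2, ⟨c p, ⟨p, hpP, ?_, rfl⟩, c p', ⟨p', hpP', ?_, rfl⟩, hcp'⟩,
    p, hpP, p', hpP', hpmax x ⟨hx, hxy.le, rfl⟩, by linarith, by linarith, hp'y⟩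
  · simpa only [hdp] using hdist
  · simpa only [hdp'] using hdist

/-- A finite labelled point set in `ℝ` has finitely many decision boundary points, since each is
the midpoint of two points of the set. -/
theorem finite_setOf_isBoundary {L : Type*} {P : Set ℝ} (c : ℝ → L) (hfin : P.Finite) :
    {b : ℝ | IsBoundary P c b}.Finite := by
  refine (hfin.image2 (fun x y : ℝ => (x + y) / 2) hfin).subset ?_
  rintro b ⟨_, ⟨p, hp, hpn, rfl⟩, _, ⟨p', hp', hpn', rfl⟩, hne⟩
  refine ⟨p, hp, p', hp', ?_⟩
  have hd : |b - p| = |b - p'| := le_antisymm (hpn p' hp') (hpn' p hp)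
  have hpp' : p ≠ p' := fun h => hne (congrArg c h)
  rcases abs_eq_abs.mp hd with h | h
  · exact absurd (by linarith) hpp'
  · change (p + p') / 2 = b
    linarith

/-- A nearest neighbor of a decision boundary point is different from that point. -/
theorem IsBoundary.ne_of_forall_dist_le {L : Type*} {P : Set ℝ} {c : ℝ → L} {b p : ℝ}
    (hb : IsBoundary P c b) (hp : p ∈ P) (hpn : ∀ p' ∈ P, dist b p ≤ dist b p') : p ≠ b := by
  rintro rfl
  obtain ⟨_, ⟨x, hx, hxn, rfl⟩, _, ⟨y, hy, hyn, rfl⟩, hne⟩ := hb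
  have key : ∀ z, (∀ p' ∈ P, dist p z ≤ dist p p') → p = z := fun z hz =>
    dist_le_zero.mp ((hz p hp).trans_eq (dist_self p))
  exact hne (by rw [← key x hxn, ← key y hyn])

/-- If some nearest neighbor of `q` in `P` lies in `Q ⊆ P`, then the nearest neighbors of `q` in
`Q` are nearest neighbors in `P`. -/
theorem nnClass_subset_of_subset {L : Type*} {P Q : Set ℝ} {c : ℝ → L} {q p : ℝ} (hQP : Q ⊆ P)
    (hp : p ∈ Q) (hpn : ∀ p' ∈ P, dist q p ≤ dist q p') : nnClass Q c q ⊆ nnClass P c q := by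
  rintro _ ⟨s, hs, hsn, rfl⟩
  exact ⟨s, hQP hs, fun p' hp' => (hsn p hp).trans (hpn p' hp'), rfl⟩

/-- A finite nonempty labelled point set assigns at least one label to every point. -/
theorem nnClass_nonempty {L : Type*} {P : Set ℝ} (c : ℝ → L) (hfin : P.Finite)
    (hne : P.Nonempty) (q : ℝ) : (nnClass P c q).Nonempty := by
  obtain ⟨p, hp, hpn⟩ := Set.exists_min_image P (dist q) hfin hne
  exact ⟨c p, p, hp, hpn, rfl⟩

/-- If `x < y` and `y` is at least as close to `q` as `x`, then `q` is not to the left of the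
midpoint of `x` and `y`. -/
theorem add_le_two_mul_of_dist_le {x y q : ℝ} (hxy : x < y) (h : dist q y ≤ dist q x) :
    x + y ≤ 2 * q := by
  rw [Real.dist_eq, Real.dist_eq] at h
  nlinarith [sq_le_sq.mpr h]

/-- If `x < y` and `x` is at least as close to `q` as `y`, then `q` is not to the right of the
midpoint of `x` and `y`. -/
theorem two_mul_le_add_of_dist_le {x y q : ℝ} (hxy : x < y) (h : dist q x ≤ dist q y) :
    2 * q ≤ x + y := by
  rw [Real.dist_eq, Real.dist_eq] at h
  nlinarith [sq_le_sq.mpr h]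

/-- Away from the decision boundary, a nearest neighbor in `Q` has the same label as a nearest
neighbor in `P`, provided that `Q` contains two points between any two points of `P` with
different labels. -/
theorem label_eq_of_not_isBoundary {L : Type*} {P Q : Set ℝ} {c : ℝ → L} {q p s : ℝ}
    (hQP : Q ⊆ P)
    (hsep : ∀ x ∈ P, ∀ y ∈ P, x < y → c x ≠ c y → ∃ u ∈ Q, ∃ v ∈ Q, x ≤ u ∧ u < v ∧ v ≤ y)
    (hq : ¬ IsBoundary P c q) (hp : p ∈ P) (hpn : ∀ p' ∈ P, dist q p ≤ dist q p')
    (hs : s ∈ Q) (hsn : ∀ s' ∈ Q, dist q s ≤ dist q s') : c s = c p := by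
  by_contra hne
  have hpQ : p ∉ Q := fun h => hq ⟨c s, ⟨s, hQP hs, fun p' hp' =>
    (hsn p h).trans (hpn p' hp'), rfl⟩, c p, ⟨p, hp, hpn, rfl⟩, hne⟩
  rcases lt_trichotomy p s with h | h | h
  · obtain ⟨u, hu, v, -, hpu, huv, hvs⟩ := hsep p hp s (hQP hs) h (Ne.symm hne)
    have hpu' : p < u := lt_of_le_of_ne hpu (by rintro rfl; exact hpQ hu)
    have h1 := two_mul_le_add_of_dist_le hpu' (hpn u (hQP hu))
    have h2 := add_le_two_mul_of_dist_le (huv.trans_le hvs) (hsn u hu)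
    linarith
  · exact hpQ (h ▸ hs)
  · obtain ⟨u, -, v, hv, hsu, huv, hvp⟩ := hsep s (hQP hs) p hp h hne
    have hvp' : v < p := lt_of_le_of_ne hvp (by rintro rfl; exact hpQ hv)
    have h1 := add_le_two_mul_of_dist_le hvp' (hpn v (hQP hv))
    have h2 := two_mul_le_add_of_dist_le (hsu.trans_lt huv) (hsn v hv)
    linarith

/-- Taking, for each decision boundary point, its closest smaller and closest larger
neighbor in `P` yields a reduced training set; in particular there is a reduced
training set of size at most `2 |B|`. -/
theorem RTS_of_boundary_neighbors {L : Type*} (P : Set ℝ) (c : ℝ → L)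
    (hfin : P.Finite) (hne : P.Nonempty)
    (B : Set ℝ) (hB : B = {b : ℝ | IsBoundary P c b}) (hBne : B.Nonempty)
    (l r : ℝ → ℝ)
    (hl : ∀ b ∈ B, IsGreatest {p ∈ P | p < b} (l b))
    (hr : ∀ b ∈ B, IsLeast {p ∈ P | b < p} (r b)) :
    IsRTS P c (l '' B ∪ r '' B) ∧ (l '' B ∪ r '' B).ncard ≤ 2 * B.ncard := by
  subst hB
  have hBfin := finite_setOf_isBoundary c hfin
  set B : Set ℝ := {b : ℝ | IsBoundary P c b}
  refine ⟨?_, ?_⟩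
  · have hQP : l '' B ∪ r '' B ⊆ P := by
      rintro _ (⟨b, hb, rfl⟩ | ⟨b, hb, rfl⟩)
      · exact (hl b hb).1.1
      · exact (hr b hb).1.1
    have hlQ : ∀ b ∈ B, l b ∈ l '' B ∪ r '' B := fun b hb => Or.inl (mem_image_of_mem l hb)
    have hrQ : ∀ b ∈ B, r b ∈ l '' B ∪ r '' B := fun b hb => Or.inr (mem_image_of_mem r hb)
    have hQne : (l '' B ∪ r '' B).Nonempty := (hBne.image l).inl
    refine ⟨hQP, funext fun q => ?_⟩
    by_cases hq : IsBoundary P c q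
    · have hnear : ∀ p ∈ P, (∀ p' ∈ P, dist q p ≤ dist q p') → p ∈ l '' B ∪ r '' B := by
        intro p hp hpn
        rcases (hq.ne_of_forall_dist_le hp hpn).lt_or_gt with h | h
        · have h1 : p ≤ l q := (hl q hq).2 ⟨hp, h⟩
          have h2 := two_mul_le_add_of_dist_le (q := q) (x := p) (y := l q)
          have h3 := (hl q hq).1.2
          obtain rfl : p = l q := by
            by_contra hne
            have := h2 (lt_of_le_of_ne h1 hne) (hpn _ (hl q hq).1.1)
            linarith
          exact hlQ q hq
        · have h1 : r q ≤ p := (hr q hq).2 ⟨hp, h⟩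
          have h2 := add_le_two_mul_of_dist_le (q := q) (x := r q) (y := p)
          have h3 := (hr q hq).1.2
          obtain rfl : p = r q := by
            by_contra hne
            have := h2 (lt_of_le_of_ne h1 (Ne.symm hne)) (hpn _ (hr q hq).1.1)
            linarith
          exact hrQ q hq
      apply Subset.antisymm
      · obtain ⟨_, p, hp, hpn, -⟩ := nnClass_nonempty c hfin hne q
        exact nnClass_subset_of_subset hQP (hnear p hp hpn) hpn
      · rintro _ ⟨p, hp, hpn, rfl⟩
        exact ⟨p, hnear p hp hpn, fun p' hp' => hpn p' (hQP hp'), rfl⟩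
    · have hsep : ∀ x ∈ P, ∀ y ∈ P, x < y → c x ≠ c y →
          ∃ u ∈ l '' B ∪ r '' B, ∃ v ∈ l '' B ∪ r '' B, x ≤ u ∧ u < v ∧ v ≤ y := by
        intro x hx y hy hxy hc
        obtain ⟨b, hb, p, hp, p', hp', hxp, hpb, hbp', hp'y⟩ :=
          exists_isBoundary_between hfin hx hy hxy hc
        exact ⟨l b, hlQ b hb, r b, hrQ b hb, hxp.trans ((hl b hb).2 ⟨hp, hpb⟩),
          (hl b hb).1.2.trans (hr b hb).1.2, ((hr b hb).2 ⟨hp', hbp'⟩).trans hp'y⟩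
      apply Subset.antisymm
      · rintro _ ⟨s, hs, hsn, rfl⟩
        obtain ⟨_, p, hp, hpn, -⟩ := nnClass_nonempty c hfin hne q
        exact ⟨p, hp, hpn, (label_eq_of_not_isBoundary hQP hsep hq hp hpn hs hsn).symm⟩
      · rintro _ ⟨p, hp, hpn, rfl⟩
        obtain ⟨_, s, hs, hsn, -⟩ := nnClass_nonempty c (hfin.subset hQP) hQne q
        exact ⟨s, hs, hsn, label_eq_of_not_isBoundary hQP hsep hq hp hpn hs hsn⟩
  · have h := ncard_union_le (l '' B) (r '' B)
    have h1 := ncard_image_le (f := l) hBfin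
    have h2 := ncard_image_le (f := r) hBfin
    omega
end

section
/- Let P ⊂ ℝ be a finite nonempty labelled point set and let Q ⊆ P be nonempty. Then Q is a reduced training set of (P,c) if and only if both of the following hold: (i) for every decision boundary point b of P, the sets {q ∈ Q : q < b} and {q ∈ Q : q > b} are nonempty and b = (max{q ∈ Q : q < b} + min{q ∈ Q : q > b})/2; and (ii) whenever q < q' are consecutive points of Q (i.e., Q ∩ (q, q') = ∅) with c(q) ≠ c(q'), the midpoint (q + q')/2 is a decision boundary point of P. -/
open Set

/-- `p` is a nearest neighbor of `x` in `P`. -/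
def IsNearest (P : Set ℝ) (x p : ℝ) : Prop :=
  p ∈ P ∧ ∀ p' ∈ P, |x - p| ≤ |x - p'|

theorem mem_nnClass {L : Type*} {P : Set ℝ} {c : ℝ → L} {x : ℝ} {l : L} :
    l ∈ nnClass P c x ↔ ∃ p, IsNearest P x p ∧ c p = l := by
  simp only [nnClass, IsNearest, Set.mem_ofPred_eq, Real.dist_eq, and_assoc]

theorem exists_isNearest {P : Set ℝ} (hfin : P.Finite) (hne : P.Nonempty) (x : ℝ) :
    ∃ p, IsNearest P x p :=
  Set.exists_min_image P (fun p => |x - p|) hfin hne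

theorem isNearest_self {P : Set ℝ} {p : ℝ} (hp : p ∈ P) : IsNearest P p p :=
  ⟨hp, fun p' _ => by simp⟩

theorem IsNearest.eq_of_mem {P : Set ℝ} {x p : ℝ} (h : IsNearest P x p) (hx : x ∈ P) : p = x := by
  have := h.2 x hx
  rw [sub_self, abs_zero] at this
  linarith [abs_nonpos_iff.mp this]

theorem IsNearest.eq_or_add_eq {P : Set ℝ} {x p q : ℝ} (hp : IsNearest P x p)
    (hq : IsNearest P x q) : p = q ∨ p + q = 2 * x := by
  rcases abs_eq_abs.mp (le_antisymm (hp.2 q hq.1) (hq.2 p hp.1)) with h | h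
  · left; linarith
  · right; linarith

/-- No point of `P` lies strictly closer to `x` than a nearest neighbor. -/
theorem IsNearest.le_or_le {P : Set ℝ} {x p t : ℝ} (h : IsNearest P x p) (ht : t ∈ P) :
    (t ≤ p ∧ t + p ≤ 2 * x) ∨ (p ≤ t ∧ 2 * x ≤ t + p) := by
  have h1 := h.2 t ht
  rcases abs_cases (x - p) with ⟨h2, _⟩ | ⟨h2, _⟩ <;>
  rcases abs_cases (x - t) with ⟨h3, _⟩ | ⟨h3, _⟩ <;>
  rw [h2, h3] at h1 <;>
  first
    | (left; constructor <;> linarith)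
    | (right; constructor <;> linarith)

theorem isNearest_of_forall {P : Set ℝ} {x p : ℝ} (hp : p ∈ P)
    (h : ∀ t ∈ P, (t ≤ p ∧ t + p ≤ 2 * x) ∨ (p ≤ t ∧ 2 * x ≤ t + p)) : IsNearest P x p := by
  refine ⟨hp, fun t ht => ?_⟩
  rcases h t ht with ⟨h1, h2⟩ | ⟨h1, h2⟩
  · exact (abs_le.mpr ⟨by linarith, by linarith⟩).trans (le_abs_self _)
  · exact (abs_le.mpr ⟨by linarith, by linarith⟩).trans (neg_le_abs _)

theorem isNearest_midpoint {P : Set ℝ} {u v : ℝ} (hu : u ∈ P) (hv : v ∈ P) (huv : u < v)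
    (h : ∀ t ∈ P, t ≤ u ∨ v ≤ t) :
    IsNearest P ((u + v) / 2) u ∧ IsNearest P ((u + v) / 2) v := by
  refine ⟨isNearest_of_forall hu fun t ht => ?_, isNearest_of_forall hv fun t ht => ?_⟩ <;>
  rcases h t ht with h1 | h1
  · left; constructor <;> linarith
  · right; constructor <;> linarith
  · left; constructor <;> linarith
  · right; constructor <;> linarith

theorem isBoundary_midpoint {L : Type*} {P : Set ℝ} {c : ℝ → L} {u v : ℝ} (hu : u ∈ P)
    (hv : v ∈ P) (huv : u < v) (h : ∀ t ∈ P, t ≤ u ∨ v ≤ t) (hc : c u ≠ c v) :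
    IsBoundary P c ((u + v) / 2) := by
  obtain ⟨h1, h2⟩ := isNearest_midpoint hu hv huv h
  exact ⟨c u, mem_nnClass.mpr ⟨u, h1, rfl⟩, c v, mem_nnClass.mpr ⟨v, h2, rfl⟩, hc⟩

/-- At a decision boundary point there are nearest neighbors with distinct labels on both sides. -/
theorem IsBoundary.exists_isNearest {L : Type*} {P : Set ℝ} {c : ℝ → L} {b : ℝ}
    (h : IsBoundary P c b) :
    ∃ u v, IsNearest P b u ∧ IsNearest P b v ∧ u < b ∧ b < v ∧ u + v = 2 * b := by
  obtain ⟨_, h1, _, h2, hne⟩ := h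
  obtain ⟨p, hp, rfl⟩ := mem_nnClass.mp h1
  obtain ⟨q, hq, rfl⟩ := mem_nnClass.mp h2
  have hpq : p ≠ q := fun h => hne (congrArg c h)
  have hsum := (hp.eq_or_add_eq hq).resolve_left hpq
  rcases hpq.lt_or_gt with hlt | hlt
  · exact ⟨p, q, hp, hq, by linarith, by linarith, hsum⟩
  · exact ⟨q, p, hq, hp, by linarith, by linarith, by linarith⟩

/-- Between two points with distinct labels there are consecutive points with distinct labels. -/
theorem exists_consecutive {L : Type*} {P : Set ℝ} {c : ℝ → L} (hfin : P.Finite) {a p : ℝ}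
    (ha : a ∈ P) (hp : p ∈ P) (hap : a < p) (hc : c a ≠ c p) :
    ∃ u ∈ P, ∃ v ∈ P, a ≤ u ∧ u < v ∧ v ≤ p ∧ (∀ t ∈ P, t ≤ u ∨ v ≤ t) ∧ c u ≠ c v := by
  obtain ⟨u, ⟨hu, hau, hup, huc⟩, humax⟩ :=
    Set.exists_max_image {t ∈ P | a ≤ t ∧ t < p ∧ c t ≠ c p} id (hfin.subset (Set.sep_subset _ _))
      ⟨a, ha, le_rfl, hap, hc⟩
  obtain ⟨v, ⟨hv, huv, hvp⟩, hvmin⟩ :=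
    Set.exists_min_image {t ∈ P | u < t ∧ t ≤ p} id (hfin.subset (Set.sep_subset _ _))
      ⟨p, hp, hup, le_rfl⟩
  refine ⟨u, hu, v, hv, hau, huv, hvp, fun t ht => ?_, fun h => ?_⟩
  · by_contra! hlt
    exact absurd (hvmin t ⟨ht, hlt.1, hlt.2.le.trans hvp⟩) (not_le.mpr hlt.2)
  · rcases hvp.eq_or_lt with rfl | hlt
    · exact huc h
    · exact absurd (humax v ⟨hv, hau.trans huv.le, hlt, h ▸ huc⟩) (not_le.mpr huv)

theorem IsNearest.exists_isBoundary_left {L : Type*} {P : Set ℝ} {c : ℝ → L} (hfin : P.Finite)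
    {x a p : ℝ} (hp : IsNearest P x p) (ha : a ∈ P) (hap : a < p) (hc : c a ≠ c p) :
    ∃ b, IsBoundary P c b ∧ a < b ∧ b ≤ x := by
  obtain ⟨u, hu, v, hv, hau, huv, hvp, hcons, huc⟩ := exists_consecutive hfin ha hp.1 hap hc
  refine ⟨(u + v) / 2, isBoundary_midpoint hu hv huv hcons huc, by linarith, ?_⟩
  rcases hp.le_or_le hu with ⟨_, _⟩ | ⟨_, _⟩ <;> linarith

theorem IsNearest.exists_isBoundary_right {L : Type*} {P : Set ℝ} {c : ℝ → L} (hfin : P.Finite)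
    {x a p : ℝ} (hp : IsNearest P x p) (ha : a ∈ P) (hap : p < a) (hc : c a ≠ c p) :
    ∃ b, IsBoundary P c b ∧ x ≤ b ∧ b < a := by
  obtain ⟨u, hu, v, hv, hau, huv, hvp, hcons, huc⟩ := exists_consecutive hfin hp.1 ha hap hc.symm
  refine ⟨(u + v) / 2, isBoundary_midpoint hu hv huv hcons huc, ?_, by linarith⟩
  rcases hp.le_or_le hv with ⟨_, _⟩ | ⟨_, _⟩ <;> linarith

/-- `b` is the midpoint of its closest smaller and larger neighbors in `Q`. -/
def IsGapMidpoint (Q : Set ℝ) (b : ℝ) : Prop :=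
  ∃ q₁ q₂ : ℝ, IsGreatest {q ∈ Q | q < b} q₁ ∧ IsLeast {q ∈ Q | b < q} q₂ ∧ b = (q₁ + q₂) / 2

theorem IsBoundary.isGapMidpoint {L : Type*} {Q : Set ℝ} {c : ℝ → L} {b : ℝ}
    (h : IsBoundary Q c b) : IsGapMidpoint Q b := by
  obtain ⟨u, v, hu, hv, hub, hbv, hsum⟩ := h.exists_isNearest
  refine ⟨u, v, ⟨⟨hu.1, hub⟩, fun t ht => ?_⟩, ⟨⟨hv.1, hbv⟩, fun t ht => ?_⟩, by linarith⟩
  · have := ht.2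
    rcases hu.le_or_le ht.1 with ⟨h1, _⟩ | ⟨_, h2⟩
    · exact h1
    · rcases hv.le_or_le ht.1 with ⟨_, _⟩ | ⟨_, _⟩ <;> linarith
  · have := ht.2
    rcases hv.le_or_le ht.1 with ⟨_, h2⟩ | ⟨h1, _⟩
    · rcases hu.le_or_le ht.1 with ⟨_, _⟩ | ⟨_, _⟩ <;> linarith
    · exact h1

/-- A gap midpoint separates the points whose nearest neighbors lie on either side of it. -/
theorem IsNearest.le_of_isGapMidpoint {Q : Set ℝ} {x q b : ℝ} (hq : IsNearest Q x q)
    (hb : IsGapMidpoint Q b) (hqb : q < b) : x ≤ b := by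
  obtain ⟨q₁, q₂, h1, h2, h3⟩ := hb
  have := h1.2 ⟨hq.1, hqb⟩
  have := h2.1.2
  rcases hq.le_or_le h2.1.1 with ⟨_, _⟩ | ⟨_, _⟩ <;> linarith

theorem IsNearest.ge_of_isGapMidpoint {Q : Set ℝ} {x q b : ℝ} (hq : IsNearest Q x q)
    (hb : IsGapMidpoint Q b) (hbq : b < q) : b ≤ x := by
  obtain ⟨q₁, q₂, h1, h2, h3⟩ := hb
  have := h2.2 ⟨hq.1, hbq⟩
  have := h1.1.2
  rcases hq.le_or_le h1.1.1 with ⟨_, _⟩ | ⟨_, _⟩ <;> linarith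

/-- If all decision boundary points of `P` are gap midpoints of `Q ⊆ P`, then nearest neighbors
in `Q` and in `P` of a point `x` have the same label, provided that they lie on the same side
of `x` in case `x` is a decision boundary point. -/
theorem label_eq_of_isGapMidpoint {L : Type*} {P Q : Set ℝ} {c : ℝ → L} (hfin : P.Finite)
    (hQP : Q ⊆ P) (hgap : ∀ b, IsBoundary P c b → IsGapMidpoint Q b) {x p q : ℝ}
    (hp : IsNearest P x p) (hq : IsNearest Q x q)
    (hside : IsBoundary P c x → (p < x ∧ q < x) ∨ (x < p ∧ x < q)) : c q = c p := by
  by_contra hc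
  have hqp : q ≠ p := fun h => hc (congrArg c h)
  rcases hqp.lt_or_gt with hlt | hlt
  · obtain ⟨b, hb, hqb, hbx⟩ := hp.exists_isBoundary_left hfin (hQP hq.1) hlt hc
    obtain rfl := le_antisymm hbx (hq.le_of_isGapMidpoint (hgap b hb) hqb)
    have hpb : p < b := by rcases hside hb with h | h <;> linarith
    obtain ⟨b', hb', hqb', hbp⟩ :=
      (isNearest_self hp.1).exists_isBoundary_left hfin (hQP hq.1) hlt hc
    linarith [hq.le_of_isGapMidpoint (hgap b' hb') hqb']
  · obtain ⟨b, hb, hxb, hbq⟩ := hp.exists_isBoundary_right hfin (hQP hq.1) hlt hc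
    obtain rfl := le_antisymm hxb (hq.ge_of_isGapMidpoint (hgap b hb) hbq)
    have hpb : x < p := by rcases hside hb with h | h <;> linarith
    obtain ⟨b', hb', hpb', hbq'⟩ :=
      (isNearest_self hp.1).exists_isBoundary_right hfin (hQP hq.1) hlt hc
    linarith [hq.ge_of_isGapMidpoint (hgap b' hb') hbq']

theorem IsGapMidpoint.exists_isNearest {Q : Set ℝ} {b : ℝ} (hb : IsGapMidpoint Q b)
    (hbQ : b ∉ Q) : ∃ u v, IsNearest Q b u ∧ IsNearest Q b v ∧ u < b ∧ b < v := by
  obtain ⟨u, v, ⟨⟨hu, hub⟩, humax⟩, ⟨⟨hv, hbv⟩, hvmin⟩, rfl⟩ := hb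
  obtain ⟨h1, h2⟩ := isNearest_midpoint hu hv (hub.trans hbv) fun t ht => by
    rcases lt_trichotomy t ((u + v) / 2) with h | h | h
    · exact Or.inl (humax ⟨ht, h⟩)
    · exact absurd (h ▸ ht) hbQ
    · exact Or.inr (hvmin ⟨ht, h⟩)
  exact ⟨u, v, h1, h2, hub, hbv⟩

theorem IsBoundary.notMem {L : Type*} {P : Set ℝ} {c : ℝ → L} {b : ℝ} (h : IsBoundary P c b) :
    b ∉ P := by
  intro hb
  obtain ⟨u, _, hu, _, hub, _⟩ := h.exists_isNearest
  exact hub.ne (hu.eq_of_mem hb)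

theorem nnClass_eq_of_isGapMidpoint {L : Type*} {P Q : Set ℝ} {c : ℝ → L} (hfin : P.Finite)
    (hQP : Q ⊆ P) (hQne : Q.Nonempty) (hgap : ∀ b, IsBoundary P c b → IsGapMidpoint Q b) :
    nnClass Q c = nnClass P c := by
  funext x
  ext l
  rw [mem_nnClass, mem_nnClass]
  by_cases hx : IsBoundary P c x
  · have hxP := hx.notMem
    obtain ⟨p₁, p₂, hp₁, hp₂, hp₁x, hxp₂, _⟩ := hx.exists_isNearest
    obtain ⟨q₁, q₂, hq₁, hq₂, hq₁x, hxq₂⟩ := (hgap x hx).exists_isNearest fun h => hxP (hQP h)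
    constructor
    · rintro ⟨q, hq, rfl⟩
      have hqx : q ≠ x := fun h => hxP (h ▸ hQP hq.1)
      rcases hqx.lt_or_gt with h | h
      · exact ⟨p₁, hp₁,
          (label_eq_of_isGapMidpoint hfin hQP hgap hp₁ hq fun _ => Or.inl ⟨hp₁x, h⟩).symm⟩
      · exact ⟨p₂, hp₂,
          (label_eq_of_isGapMidpoint hfin hQP hgap hp₂ hq fun _ => Or.inr ⟨hxp₂, h⟩).symm⟩
    · rintro ⟨p, hp, rfl⟩
      have hpx : p ≠ x := fun h => hxP (h ▸ hp.1)
      rcases hpx.lt_or_gt with h | h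
      · exact ⟨q₁, hq₁,
          label_eq_of_isGapMidpoint hfin hQP hgap hp hq₁ fun _ => Or.inl ⟨h, hq₁x⟩⟩
      · exact ⟨q₂, hq₂,
          label_eq_of_isGapMidpoint hfin hQP hgap hp hq₂ fun _ => Or.inr ⟨h, hxq₂⟩⟩
  · constructor
    · rintro ⟨q, hq, rfl⟩
      obtain ⟨p, hp⟩ := exists_isNearest hfin (hQne.mono hQP) x
      exact ⟨p, hp, (label_eq_of_isGapMidpoint hfin hQP hgap hp hq fun h => absurd h hx).symm⟩
    · rintro ⟨p, hp, rfl⟩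
      obtain ⟨q, hq⟩ := exists_isNearest (hfin.subset hQP) hQne x
      exact ⟨q, hq, label_eq_of_isGapMidpoint hfin hQP hgap hp hq fun h => absurd h hx⟩

/-- Characterization of reduced training sets in `ℝ`: a nonempty `Q ⊆ P` is a reduced
training set iff (i) every decision boundary point of `P` is the midpoint of its
closest smaller and larger neighbors in `Q`, and (ii) the midpoint of any two
consecutive points of `Q` with different labels is a decision boundary point of `P`. -/
theorem RTS_iff {L : Type*} (P : Set ℝ) (c : ℝ → L)
    (hfin : P.Finite) (hne : P.Nonempty)
    (Q : Set ℝ) (hQP : Q ⊆ P) (hQne : Q.Nonempty) :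
    IsRTS P c Q ↔
      ((∀ b : ℝ, IsBoundary P c b →
          ∃ q₁ q₂ : ℝ, IsGreatest {q ∈ Q | q < b} q₁ ∧ IsLeast {q ∈ Q | b < q} q₂ ∧
            b = (q₁ + q₂) / 2) ∧
        (∀ q ∈ Q, ∀ q' ∈ Q, q < q' → Q ∩ Set.Ioo q q' = ∅ → c q ≠ c q' →
          IsBoundary P c ((q + q') / 2))) := by
  constructor
  · rintro ⟨_, heq⟩
    have hiff : ∀ b, IsBoundary P c b ↔ IsBoundary Q c b := fun b => by
      rw [IsBoundary, IsBoundary, heq]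
    refine ⟨fun b hb => ((hiff b).mp hb).isGapMidpoint, fun q hq q' hq' hlt hcons hc => ?_⟩
    refine (hiff _).mpr (isBoundary_midpoint hq hq' hlt (fun t ht => ?_) hc)
    by_contra! h
    exact (Set.eq_empty_iff_forall_notMem.mp hcons t) ⟨ht, h⟩
  · rintro ⟨hgap, _⟩
    exact ⟨hQP, nnClass_eq_of_isGapMidpoint hfin hQP hQne hgap⟩
end
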